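/- Let M : ℕ⁴ → ℕ satisfy: M(0,0,0,a) = ⌊a/2⌋; M(x,y,2z+i,a) = M(x,y,z, M(x,y,z,a)) whenever 2z+i ≠ 0; M(x,2y+i,0,a) = M(x,y,x,a) whenever 2y+i ≠ 0; and M(2x+i,0,0,a) = M(x,0,0,a) whenever 2x+i ≠ 0 (for all x,y,z,a ∈ ℕ and i ∈ {0,1}). Then for all x,y,z,a ∈ ℕ: M(x,y,z,a) = ⌊a / 2^{2^{|x|·|y| + |z|}}⌋. -/

import Mathlib

/-- Induction on the binary digits of a natural number. -/
theorem Nat.binary_digit_induction {P : ℕ → Prop} (zero : P 0)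
    (step : ∀ n i, i ≤ 1 → 2 * n + i ≠ 0 → P n → P (2 * n + i)) (n : ℕ) : P n := by
  induction n using Nat.strong_induction_on with
  | _ n ih =>
    rcases Nat.eq_zero_or_pos n with rfl | hn
    · exact zero
    · have h := step (n / 2) (n % 2) (by omega) (by omega) (ih _ (by omega))
      rwa [Nat.div_add_mod] at h

theorem Nat.size_two_mul_add {n i : ℕ} (hi : i ≤ 1) (h : 2 * n + i ≠ 0) :
    Nat.size (2 * n + i) = Nat.size n + 1 := by
  obtain rfl | rfl : i = 0 ∨ i = 1 := by omega
  · simpa [Nat.bit] using Nat.size_bit (b := false) (n := n) (by simpa [Nat.bit] using h)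
  · simpa [Nat.bit] using Nat.size_bit (b := true) (n := n) (by simp [Nat.bit])

theorem stmt15 (M : ℕ → ℕ → ℕ → ℕ → ℕ)
    (h0 : ∀ a, M 0 0 0 a = a / 2)
    (h1 : ∀ x y z a i, i ≤ 1 → 2 * z + i ≠ 0 →
      M x y (2 * z + i) a = M x y z (M x y z a))
    (h2 : ∀ x y a i, i ≤ 1 → 2 * y + i ≠ 0 →
      M x (2 * y + i) 0 a = M x y x a)
    (h3 : ∀ x a i, i ≤ 1 → 2 * x + i ≠ 0 →
      M (2 * x + i) 0 0 a = M x 0 0 a) :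
    ∀ x y z a, M x y z a = a / 2 ^ 2 ^ (Nat.size x * Nat.size y + Nat.size z) := by
  have extend : ∀ x y, (∀ a, M x y 0 a = a / 2 ^ 2 ^ (Nat.size x * Nat.size y)) →
      ∀ z a, M x y z a = a / 2 ^ 2 ^ (Nat.size x * Nat.size y + Nat.size z) := by
    intro x y hxy z
    induction z using Nat.binary_digit_induction with
    | zero => simpa using hxy
    | step z i hi hz ih =>
      intro a
      rw [h1 x y z a i hi hz, ih, ih, Nat.div_div_eq_div_mul, Nat.size_two_mul_add hi hz,
        ← pow_add, ← add_assoc, pow_succ 2 (_ + _), mul_two]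
  have base : ∀ x a, M x 0 0 a = a / 2 := by
    intro x
    induction x using Nat.binary_digit_induction with
    | zero => exact h0
    | step x i hi hx ih =>
      intro a
      rw [h3 x a i hi hx, ih]
  intro x y
  apply extend
  induction y using Nat.binary_digit_induction with
  | zero => simpa using base x
  | step y i hi hy ih =>
    intro a
    rw [h2 x y a i hi hy, extend x y ih, Nat.size_two_mul_add hi hy, mul_add_one]
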